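/- arXiv:2210.00656 — 2 statements merged into one kernel-verified Lean document; each statement's English description precedes it below -/
import Mathlib

section
/- Fix an integer ν ≥ 3. Suppose M = M(n) is a sequence of positive integers with M(n) → ∞ and log M(n) = O(n), and suppose n/log M(n) converges to a limit κ with κ < 2/log ν. Then E[Z_n] → 0 as n → ∞ (and consequently the probability that a perfect partition exists tends to 0). -/
open Filter

/-- The number of perfect ordered partitions of `{1,…,n}` into `ν` nonempty parts,
for the integer values `X 0, …, X (n-1)`: ordered partitions into `ν` labeled nonempty
subsets correspond to surjections `σ : Fin n → Fin ν`, and perfection means all part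
sums are equal. -/
noncomputable def perfectCount (ν n : ℕ) (X : Fin n → ℕ) : ℕ :=
  Set.ncard {σ : Fin n → Fin ν | Function.Surjective σ ∧
    ∀ α β : Fin ν,
      (∑ j ∈ Finset.univ.filter fun j => σ j = α, X j) =
      (∑ j ∈ Finset.univ.filter fun j => σ j = β, X j)}

/-- `E[Z_n]` for `X_1,…,X_n` i.i.d. uniform on `{1,…,M}`: the average of
`perfectCount` over all `M^n` equally likely outcomes. -/
noncomputable def EZ (ν n M : ℕ) : ℝ :=
  (∑ X : Fin n → Fin M, ((perfectCount ν n fun j => (X j : ℕ) + 1) : ℝ)) / (M : ℝ) ^ n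

/-- `P(Z_n > 0)`, i.e. the probability that a perfect partition exists. -/
noncomputable def prPos (ν n M : ℕ) : ℝ :=
  ((Set.ncard {X : Fin n → Fin M | 0 < perfectCount ν n fun j => (X j : ℕ) + 1}) : ℝ)
    / (M : ℝ) ^ n

/-- The part sums of `X` with respect to the labelling `σ` are all equal. -/
def IsBalanced {ν n : ℕ} (σ : Fin n → Fin ν) (X : Fin n → ℕ) : Prop :=
  ∀ α β : Fin ν,
    (∑ j ∈ Finset.univ.filter fun j => σ j = α, X j) =
    (∑ j ∈ Finset.univ.filter fun j => σ j = β, X j)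

/-- A balanced vector is determined by its values off the representatives `r α`, `α ≠ β`,
of all parts but one. -/
lemma IsBalanced.eq_of_eq_off_section {ν n : ℕ} {σ : Fin n → Fin ν} {r : Fin ν → Fin n}
    (hr : ∀ α, σ (r α) = α) (β : Fin ν) {X Y : Fin n → ℕ}
    (hX : IsBalanced σ X) (hY : IsBalanced σ Y)
    (h : ∀ j, (∀ α, α ≠ β → j ≠ r α) → X j = Y j) : X = Y := by
  have hβ : (∑ j ∈ Finset.univ.filter fun j => σ j = β, X j) =
      ∑ j ∈ Finset.univ.filter fun j => σ j = β, Y j := by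
    refine Finset.sum_congr rfl fun j hj => h j ?_
    rintro α hα rfl
    exact hα (by simpa [hr] using hj)
  funext j
  by_cases hj : ∀ α, α ≠ β → j ≠ r α
  · exact h j hj
  push Not at hj
  obtain ⟨α, hα, rfl⟩ := hj
  have hsum := (hX α β).trans (hβ.trans (hY β α))
  have hmem : r α ∈ Finset.univ.filter fun j => σ j = α := by simp [hr]
  rw [← Finset.add_sum_erase _ _ hmem, ← Finset.add_sum_erase _ _ hmem] at hsum
  have hrest : ∑ j ∈ (Finset.univ.filter fun j => σ j = α).erase (r α), X j =
      ∑ j ∈ (Finset.univ.filter fun j => σ j = α).erase (r α), Y j := by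
    refine Finset.sum_congr rfl fun j hj => h j ?_
    rintro γ - rfl
    simp only [Finset.mem_erase, Finset.mem_filter, Finset.mem_univ, true_and, hr] at hj
    exact hj.1 (by rw [hj.2])
  omega

open Classical in
/-- For a surjective labelling, at most a proportion `1 / M ^ (ν - 1)` of the vectors is
balanced. -/
lemma card_balanced_mul_le {ν n M : ℕ} (hν : 0 < ν) {σ : Fin n → Fin ν}
    (hσ : Function.Surjective σ) :
    (Finset.univ.filter fun X : Fin n → Fin M =>
      IsBalanced σ fun j => (X j : ℕ) + 1).card * M ^ (ν - 1) ≤ M ^ n := by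
  obtain ⟨r, hr⟩ := hσ.hasRightInverse
  have hr' : ∀ α, σ (r α) = α := hr
  let β : Fin ν := ⟨0, hν⟩
  let R : Finset (Fin n) := (Finset.univ.erase β).image r
  have hR : R.card = ν - 1 := by
    rw [Finset.card_image_of_injective _ hr.injective]
    simp
  have hcard : (Finset.univ.filter fun X : Fin n → Fin M =>
      IsBalanced σ fun j => (X j : ℕ) + 1).card ≤
      (Finset.univ : Finset ((Rᶜ : Finset (Fin n)) → Fin M)).card := by
    refine Finset.card_le_card_of_injOn (fun X j => X j) (fun _ _ => Finset.mem_univ _) ?_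
    intro X hX Y hY hXY
    have hX' : IsBalanced σ fun j => (X j : ℕ) + 1 := by simpa using hX
    have hY' : IsBalanced σ fun j => (Y j : ℕ) + 1 := by simpa using hY
    have := hX'.eq_of_eq_off_section hr' β hY' fun j hj => by
      have hj' : j ∈ Rᶜ := by
        simp only [R, Finset.mem_compl, Finset.mem_image, Finset.mem_erase, Finset.mem_univ,
          and_true, not_exists, not_and]
        exact fun α hα h => hj α hα h.symm
      have := congrFun hXY ⟨j, hj'⟩
      simp only at this
      rw [this]
    funext j
    have := congrFun this j
    exact Fin.ext (by simpa using this)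
  have hle : ν - 1 ≤ n := by
    have := Finset.card_le_univ R
    simpa [hR] using this
  have hpow : M ^ n = M ^ (n - (ν - 1)) * M ^ (ν - 1) := by
    rw [← pow_add, Nat.sub_add_cancel hle]
  rw [hpow]
  refine Nat.mul_le_mul_right _ (hcard.trans_eq ?_)
  simp [hR]

open Classical in
lemma perfectCount_eq_card (ν n : ℕ) (X : Fin n → ℕ) :
    perfectCount ν n X =
      (Finset.univ.filter fun σ : Fin n → Fin ν =>
        Function.Surjective σ ∧ IsBalanced σ X).card := by
  rw [perfectCount, ← Set.ncard_coe_finset, Finset.coe_filter]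
  simp only [IsBalanced, Finset.mem_univ, true_and]

/-- First moment bound. -/
lemma EZ_le {ν n M : ℕ} (hν : 0 < ν) (hM : 0 < M) :
    EZ ν n M ≤ (ν : ℝ) ^ n / (M : ℝ) ^ (ν - 1) := by
  classical
  have hsum : ∑ X : Fin n → Fin M, perfectCount ν n (fun j => (X j : ℕ) + 1) =
      ∑ σ : Fin n → Fin ν, (Finset.univ.filter fun X : Fin n → Fin M =>
        Function.Surjective σ ∧ IsBalanced σ fun j => (X j : ℕ) + 1).card := by
    simp only [perfectCount_eq_card]
    exact Finset.sum_card_bipartiteAbove_eq_sum_card_bipartiteBelow _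
  have hbound : (∑ X : Fin n → Fin M, perfectCount ν n (fun j => (X j : ℕ) + 1)) *
      M ^ (ν - 1) ≤ ν ^ n * M ^ n := by
    rw [hsum, Finset.sum_mul]
    refine (Finset.sum_le_card_nsmul _ _ (M ^ n) fun σ _ => ?_).trans_eq (by simp)
    by_cases hσ : Function.Surjective σ
    · simpa [hσ] using card_balanced_mul_le hν hσ
    · simp [hσ]
  have hM' : (0 : ℝ) < M := by exact_mod_cast hM
  rw [EZ, div_le_div_iff₀ (by positivity) (by positivity)]
  exact_mod_cast hbound

/-- Markov's inequality for the number of perfect partitions. -/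
lemma prPos_le_EZ (ν n M : ℕ) : prPos ν n M ≤ EZ ν n M := by
  classical
  unfold prPos EZ
  gcongr
  have : {X : Fin n → Fin M | 0 < perfectCount ν n fun j => (X j : ℕ) + 1} =
      ↑(Finset.univ.filter fun X : Fin n → Fin M =>
        0 < perfectCount ν n fun j => (X j : ℕ) + 1) := by simp
  rw [this, Set.ncard_coe_finset, Finset.card_filter]
  push_cast
  refine Finset.sum_le_sum fun X _ => ?_
  split_ifs with h
  · exact_mod_cast h
  · positivity

/-- If `n / log (M n)` has a limit below `2 / log ν`, then `ν ^ n = o((M n) ^ 2)`. -/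
lemma tendsto_pow_div_sq_zero {ν : ℕ} (hν : 2 ≤ ν) {M : ℕ → ℕ} (hMtop : Tendsto M atTop atTop)
    {κ : ℝ} (hκ : Tendsto (fun n : ℕ => (n : ℝ) / Real.log (M n)) atTop (nhds κ))
    (hκlt : κ < 2 / Real.log ν) :
    Tendsto (fun n => (ν : ℝ) ^ n / (M n : ℝ) ^ 2) atTop (nhds 0) := by
  have hlogν : 0 < Real.log ν := Real.log_pos (by exact_mod_cast hν)
  have hlogM : Tendsto (fun n => Real.log (M n)) atTop atTop :=
    Real.tendsto_log_atTop.comp (tendsto_natCast_atTop_atTop.comp hMtop)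
  have hneg : κ * Real.log ν - 2 < 0 := by
    rw [lt_div_iff₀ hlogν] at hκlt
    linarith
  have hexp := Real.tendsto_exp_atBot.comp
    (hlogM.atTop_mul_neg hneg ((hκ.mul_const (Real.log ν)).sub_const 2))
  refine hexp.congr' ?_
  filter_upwards [hlogM.eventually_gt_atTop 0, hMtop.eventually_gt_atTop 0] with n hn hMn
  have hM' : (0 : ℝ) < M n := by exact_mod_cast hMn
  have hν' : (0 : ℝ) < ν := by positivity
  have hexponent : Real.log (M n) * ((n : ℝ) / Real.log (M n) * Real.log ν - 2) =
      n * Real.log ν - (2 : ℕ) * Real.log (M n) := by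
    push_cast
    field_simp
  rw [Function.comp_apply, hexponent, Real.exp_sub, Real.exp_nat_mul, Real.exp_nat_mul,
    Real.exp_log hν', Real.exp_log hM']

theorem expected_number_tends_to_zero
    (ν : ℕ) (hν : 3 ≤ ν) (M : ℕ → ℕ) (hM1 : ∀ n, 1 ≤ M n)
    (hMtop : Tendsto M atTop atTop)
    (hMO : ∃ C : ℝ, ∀ n : ℕ, Real.log (M n) ≤ C * n)
    (κ : ℝ)
    (hκ : Tendsto (fun n : ℕ => (n : ℝ) / Real.log (M n)) atTop (nhds κ))
    (hκlt : κ < 2 / Real.log ν) :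
    Tendsto (fun n => EZ ν n (M n)) atTop (nhds 0) ∧
      Tendsto (fun n => prPos ν n (M n)) atTop (nhds 0) := by
  have hEZ : Tendsto (fun n => EZ ν n (M n)) atTop (nhds 0) := by
    refine squeeze_zero (fun n => ?_) (fun n => ?_)
      (tendsto_pow_div_sq_zero (by omega) hMtop hκ hκlt)
    · unfold EZ
      positivity
    · have hM : (1 : ℝ) ≤ M n := by exact_mod_cast hM1 n
      refine (EZ_le (by omega) (hM1 n)).trans ?_
      gcongr
      omega
  refine ⟨hEZ, squeeze_zero (fun n => ?_) (fun n => prPos_le_EZ ν n (M n)) hEZ⟩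
  unfold prPos
  positivity
end

section
/- Let ν = 3. Suppose M = M(n) is a sequence of positive integers with M(n) → ∞ and log M(n) = O(n), and suppose n/log M(n) converges to a limit κ with κ ∈ (2/log 3, ∞) \ {2, 4}. Then, with c_M := M^{−2}·E[X²] = (M+1)(2M+1)/(6M²), one has E[Z_n] = (1+o(1)) · (3^n / M²) · 3^{3/2} / (2π·3·c_M·n) as n → ∞; in particular E[Z_n] → ∞. -/
open Filter

/-- `c_M = M⁻²·E[X²] = (M+1)(2M+1)/(6M²)` for `X` uniform on `{1,…,M}`. -/
noncomputable def cM (M : ℕ) : ℝ := ((M : ℝ) + 1) * (2 * (M : ℝ) + 1) / (6 * (M : ℝ) ^ 2)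

open MeasureTheory Topology

/-- The characteristic function of the uniform distribution on `{1,…,M}`. -/
noncomputable def uniformChar (M : ℕ) (a : ℝ) : ℂ :=
  (∑ x : Fin M, Complex.exp (Complex.I * (((x : ℕ) + 1 : ℝ) * a : ℝ))) / M

/-- The characteristic function of one step of the walk of sum differences `(S₁ - S₂, S₂ - S₃)`. -/
noncomputable def stepChar (M : ℕ) (θ : ℝ × ℝ) : ℂ :=
  (uniformChar M θ.1 + uniformChar M (θ.2 - θ.1) + uniformChar M (-θ.2)) / 3

/-- The contribution of one element to the first sum difference, by the part containing it. -/
def firstStep : Fin 3 → ℤ := ![1, -1, 0]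

/-- The contribution of one element to the second sum difference, by the part containing it. -/
def secondStep : Fin 3 → ℤ := ![0, 1, -1]

/-- The square `[-π, π]²`. -/
def torusBox : Set (ℝ × ℝ) := Set.Icc (-Real.pi) Real.pi ×ˢ Set.Icc (-Real.pi) Real.pi

lemma continuous_uniformChar (M : ℕ) : Continuous (uniformChar M) := by
  unfold uniformChar
  fun_prop

lemma continuous_stepChar (M : ℕ) : Continuous (stepChar M) := by
  have := continuous_uniformChar M
  unfold stepChar
  fun_prop

lemma equal_sums_iff {n : ℕ} (hn : 0 < n) (X : Fin n → ℕ) (hX : ∀ j, 0 < X j)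
    (σ : Fin n → Fin 3) :
    (Function.Surjective σ ∧ ∀ α β : Fin 3,
      (∑ j ∈ Finset.univ.filter fun j => σ j = α, X j) =
      (∑ j ∈ Finset.univ.filter fun j => σ j = β, X j)) ↔
    (∑ j, (X j : ℤ) * firstStep (σ j) = 0 ∧ ∑ j, (X j : ℤ) * secondStep (σ j) = 0) := by
  set S : Fin 3 → ℕ := fun α => ∑ j ∈ Finset.univ.filter fun j => σ j = α, X j with hS
  have h1 : ∑ j, (X j : ℤ) * firstStep (σ j) = S 0 - S 1 := by
    simp only [hS, Finset.sum_filter]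
    push_cast
    rw [← Finset.sum_sub_distrib]
    refine Finset.sum_congr rfl fun j _ => ?_
    generalize σ j = s
    fin_cases s <;> simp [firstStep]
  have h2 : ∑ j, (X j : ℤ) * secondStep (σ j) = S 1 - S 2 := by
    simp only [hS, Finset.sum_filter]
    push_cast
    rw [← Finset.sum_sub_distrib]
    refine Finset.sum_congr rfl fun j _ => ?_
    generalize σ j = s
    fin_cases s <;> simp [secondStep]
  rw [h1, h2]
  constructor
  · rintro ⟨-, h⟩
    have a := h 0 1
    have b := h 1 2
    change S 0 = S 1 at a
    change S 1 = S 2 at b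
    omega
  · rintro ⟨a, b⟩
    have all : ∀ α, S α = S 0 := by
      intro α
      fin_cases α <;> simp <;> omega
    refine ⟨fun α => ?_, fun α β => (all α).trans (all β).symm⟩
    by_contra hne
    have h0 : S α = 0 := by
      refine Finset.sum_eq_zero fun j hj => ?_
      exact absurd ⟨j, (Finset.mem_filter.mp hj).2⟩ hne
    have hj : X ⟨0, hn⟩ ≤ S (σ ⟨0, hn⟩) :=
      Finset.single_le_sum (f := X) (fun _ _ => Nat.zero_le _) (by simp)
    have := hX ⟨0, hn⟩
    have := all α
    have := all (σ ⟨0, hn⟩)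
    omega

open Classical in
lemma perfectCount_eq_sum {n : ℕ} (hn : 0 < n) (X : Fin n → ℕ) (hX : ∀ j, 0 < X j) :
    (perfectCount 3 n X : ℂ) = ∑ σ : Fin n → Fin 3,
      (if ∑ j, (X j : ℤ) * firstStep (σ j) = 0 then 1 else 0) *
      (if ∑ j, (X j : ℤ) * secondStep (σ j) = 0 then 1 else 0) := by
  unfold perfectCount
  simp_rw [equal_sums_iff hn X hX]
  rw [Set.ncard_eq_toFinset_card']
  simp only [Set.toFinset_ofPred, Finset.card_filter]
  push_cast
  refine Finset.sum_congr rfl fun σ _ => ?_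
  rw [ite_and]
  split_ifs <;> simp

lemma integral_exp_int_mul (k : ℤ) :
    ∫ t in Set.Icc (-Real.pi) Real.pi, Complex.exp (Complex.I * (k * t : ℝ)) =
      if k = 0 then (2 * Real.pi : ℂ) else 0 := by
  rw [integral_Icc_eq_integral_Ioc,
    ← intervalIntegral.integral_of_le (by linarith [Real.pi_pos])]
  split_ifs with h
  · subst h
    simp
    ring
  · have hc : (k : ℂ) * Complex.I ≠ 0 := by simp [h]
    have := integral_exp_mul_complex (a := -Real.pi) (b := Real.pi) hc
    have e : ∀ t : ℝ, Complex.I * (k * t : ℝ) = (k : ℂ) * Complex.I * t := by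
      intro t; push_cast; ring
    simp_rw [e]
    rw [this, div_eq_zero_iff]
    left
    rw [sub_eq_zero, Complex.exp_eq_exp_iff_exists_int]
    exact ⟨k, by push_cast; ring⟩

lemma integral_torusBox_exp (k l : ℤ) :
    ∫ θ in torusBox, Complex.exp (Complex.I * (k * θ.1 + l * θ.2 : ℝ)) =
      4 * Real.pi ^ 2 * ((if k = 0 then 1 else 0) * (if l = 0 then 1 else 0)) := by
  have h := setIntegral_prod_mul (μ := (volume : Measure ℝ)) (ν := (volume : Measure ℝ))
    (fun t : ℝ => Complex.exp (Complex.I * (k * t : ℝ)))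
    (fun t : ℝ => Complex.exp (Complex.I * (l * t : ℝ)))
    (Set.Icc (-Real.pi) Real.pi) (Set.Icc (-Real.pi) Real.pi)
  rw [integral_exp_int_mul, integral_exp_int_mul] at h
  have e : ∀ θ : ℝ × ℝ, Complex.exp (Complex.I * (k * θ.1 + l * θ.2 : ℝ)) =
      Complex.exp (Complex.I * (k * θ.1 : ℝ)) * Complex.exp (Complex.I * (l * θ.2 : ℝ)) := by
    intro θ
    rw [← Complex.exp_add]
    push_cast
    ring_nf
  simp_rw [e]
  unfold torusBox
  rw [Measure.volume_eq_prod]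
  refine h.trans ?_
  split_ifs <;> simp
  ring

lemma sum_exp_eq_stepChar_pow {M : ℕ} (hM : 0 < M) (n : ℕ) (θ : ℝ × ℝ) :
    ∑ X : Fin n → Fin M, ∑ σ : Fin n → Fin 3,
      Complex.exp (Complex.I *
        (((∑ j, (((X j : ℕ) + 1 : ℕ) : ℤ) * firstStep (σ j) : ℤ) : ℝ) * θ.1 +
         ((∑ j, (((X j : ℕ) + 1 : ℕ) : ℤ) * secondStep (σ j) : ℤ) : ℝ) * θ.2 : ℝ)) =
      (3 * M * stepChar M θ) ^ n := by
  have hM' : (M : ℂ) ≠ 0 := by exact_mod_cast hM.ne'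
  have key : 3 * M * stepChar M θ = ∑ p : Fin M × Fin 3,
      Complex.exp (Complex.I * ((((p.1 : ℕ) + 1 : ℝ) *
        (firstStep p.2 * θ.1 + secondStep p.2 * θ.2) : ℝ))) := by
    rw [Fintype.sum_prod_type_right, Fin.sum_univ_three]
    unfold stepChar uniformChar
    have h0 : (firstStep 0 * θ.1 + secondStep 0 * θ.2 : ℝ) = θ.1 := by
      simp [firstStep, secondStep]
    have h1 : (firstStep 1 * θ.1 + secondStep 1 * θ.2 : ℝ) = θ.2 - θ.1 := by
      simp [firstStep, secondStep]
      ring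
    have h2 : (firstStep 2 * θ.1 + secondStep 2 * θ.2 : ℝ) = -θ.2 := by
      simp [firstStep, secondStep]
    simp only [h0, h1, h2]
    rw [← add_div, ← add_div]
    rw [mul_comm 3 (M : ℂ), mul_assoc, mul_div_cancel₀ _ (by norm_num), mul_div_cancel₀ _ hM']
  rw [key, Fintype.sum_pow, ← Fintype.sum_prod_type', ← (Equiv.arrowProdEquivProdArrow
    (Fin n) (fun _ => Fin M) (fun _ => Fin 3)).sum_comp]
  refine Finset.sum_congr rfl fun p _ => ?_
  rw [← Complex.exp_sum, ← Finset.mul_sum]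
  congr 2
  push_cast
  simp only [Equiv.arrowProdEquivProdArrow, Equiv.coe_fn_mk]
  rw [Finset.sum_mul, Finset.sum_mul, ← Finset.sum_add_distrib]
  exact Finset.sum_congr rfl fun j _ => by ring

lemma integrableOn_torusBox {f : ℝ × ℝ → ℂ} (hf : Continuous f) : IntegrableOn f torusBox :=
  hf.continuousOn.integrableOn_compact (isCompact_Icc.prod isCompact_Icc)

/-- Fourier inversion: the expectation as an integral over the torus. -/
lemma EZ_eq_integral {n M : ℕ} (hn : 0 < n) (hM : 0 < M) :
    (EZ 3 n M : ℂ) = 3 ^ n / (4 * Real.pi ^ 2) * ∫ θ in torusBox, stepChar M θ ^ n := by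
  have hM' : (M : ℂ) ≠ 0 := by exact_mod_cast hM.ne'
  have hpi : (Real.pi : ℂ) ≠ 0 := by exact_mod_cast Real.pi_ne_zero
  have h : ∫ θ in torusBox, (3 * M * stepChar M θ) ^ n =
      4 * Real.pi ^ 2 * ∑ X : Fin n → Fin M, (perfectCount 3 n fun j => (X j : ℕ) + 1 : ℂ) := by
    simp_rw [← sum_exp_eq_stepChar_pow hM]
    rw [integral_finsetSum _ fun X _ => integrableOn_torusBox (by fun_prop), Finset.mul_sum]
    refine Finset.sum_congr rfl fun X _ => ?_
    rw [integral_finsetSum _ fun X _ => integrableOn_torusBox (by fun_prop),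
      perfectCount_eq_sum hn _ (fun _ => Nat.succ_pos _), Finset.mul_sum]
    exact Finset.sum_congr rfl fun σ _ => integral_torusBox_exp _ _
  simp_rw [mul_pow] at h
  rw [integral_const_mul] at h
  unfold EZ
  push_cast at h ⊢
  rw [div_eq_iff (by positivity)]
  field_simp
  linear_combination -h

lemma norm_uniformChar_mul_sin {M : ℕ} (hM : 0 < M) (a : ℝ) :
    ‖uniformChar M a‖ * (M * |Real.sin (a / 2)|) = |Real.sin (M * a / 2)| := by
  have hM' : (M : ℝ) ≠ 0 := by exact_mod_cast hM.ne'
  set w := Complex.exp (Complex.I * a) with hw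
  have hsum : ∑ x : Fin M, Complex.exp (Complex.I * (((x : ℕ) + 1 : ℝ) * a : ℝ)) =
      w * ∑ i ∈ Finset.range M, w ^ i := by
    rw [Finset.mul_sum, ← Fin.sum_univ_eq_sum_range (fun i => w * w ^ i)]
    refine Finset.sum_congr rfl fun x _ => ?_
    rw [hw, ← Complex.exp_nat_mul, ← Complex.exp_add]
    push_cast
    ring_nf
  have hpow : w ^ M = Complex.exp (Complex.I * (M * a : ℝ)) := by
    rw [hw, ← Complex.exp_nat_mul]
    push_cast
    ring_nf
  have hnw : ‖w‖ = 1 := by rw [hw, mul_comm]; exact Complex.norm_exp_ofReal_mul_I a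
  have hg := congrArg norm (geom_sum_mul w M)
  rw [norm_mul, hpow, hw, Complex.norm_exp_I_mul_ofReal_sub_one,
    Complex.norm_exp_I_mul_ofReal_sub_one, ← hw] at hg
  simp only [Real.norm_eq_abs, abs_mul, abs_two] at hg
  unfold uniformChar
  rw [hsum, norm_div, norm_mul, hnw, Complex.norm_natCast]
  field_simp
  linarith

lemma norm_uniformChar_le_one (M : ℕ) (a : ℝ) : ‖uniformChar M a‖ ≤ 1 := by
  unfold uniformChar
  rw [norm_div, Complex.norm_natCast]
  refine div_le_one_of_le₀ ((norm_sum_le _ _).trans ?_) (Nat.cast_nonneg _)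
  simp [Complex.norm_exp]

lemma norm_uniformChar_le_inv {M : ℕ} (hM : 0 < M) {a K : ℝ} (hK : 0 < K)
    (h : K ≤ M * |Real.sin (a / 2)|) : ‖uniformChar M a‖ ≤ 1 / K := by
  have := norm_uniformChar_mul_sin hM a
  have h1 : |Real.sin (M * a / 2)| ≤ 1 := Real.abs_sin_le_one _
  rw [le_div_iff₀ hK]
  calc ‖uniformChar M a‖ * K ≤ ‖uniformChar M a‖ * (M * |Real.sin (a / 2)|) := by gcongr
    _ ≤ 1 := by rw [this]; exact h1

lemma sin_le_self_mul_one_sub {z : ℝ} (h0 : 0 ≤ z) (h2 : z ≤ 2) :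
    Real.sin z ≤ z * (1 - z ^ 2 / 20) := by
  have hc : Real.cos (z / 2) ≤ 1 - 2 / Real.pi ^ 2 * (z / 2) ^ 2 :=
    Real.cos_le_one_sub_mul_cos_sq (by rw [abs_of_nonneg (by linarith)]; linarith [Real.pi_gt_three])
  have hp : 1 / 5 ≤ 2 / Real.pi ^ 2 := by
    rw [div_le_div_iff₀ (by norm_num) (by positivity)]
    nlinarith [Real.pi_lt_d2, Real.pi_gt_three]
  have hs : Real.sin (z / 2) ≤ z / 2 := Real.sin_le (by linarith)
  have hs0 : 0 ≤ Real.sin (z / 2) :=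
    Real.sin_nonneg_of_nonneg_of_le_pi (by linarith) (by linarith [Real.pi_gt_three])
  have hc' : Real.cos (z / 2) ≤ 1 - z ^ 2 / 20 := by nlinarith [sq_nonneg (z / 2)]
  have e : Real.sin z = 2 * Real.sin (z / 2) * Real.cos (z / 2) := by
    rw [← Real.sin_two_mul]; ring_nf
  rw [e]
  have : 0 ≤ 1 - z ^ 2 / 20 := by nlinarith
  nlinarith [mul_le_mul_of_nonneg_left hc' hs0, mul_le_mul_of_nonneg_right hs this]

lemma two_div_pi_mul_abs_le_abs_sin {y : ℝ} (hy : |y| ≤ Real.pi / 2) :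
    2 / Real.pi * |y| ≤ |Real.sin y| := by
  have h : Real.sin |y| ≤ |Real.sin y| := by
    rcases abs_choice y with h | h <;> rw [h]
    · exact le_abs_self _
    · rw [Real.sin_neg]; exact neg_le_abs _
  exact (Real.mul_le_sin (abs_nonneg y) hy).trans h

lemma norm_uniformChar_neg (M : ℕ) (a : ℝ) :
    ‖uniformChar M (-a)‖ = ‖uniformChar M a‖ := by
  unfold uniformChar
  have : ∑ x : Fin M, Complex.exp (Complex.I * (((x : ℕ) + 1 : ℝ) * -a : ℝ)) =
      starRingEnd ℂ (∑ x : Fin M, Complex.exp (Complex.I * (((x : ℕ) + 1 : ℝ) * a : ℝ))) := by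
    rw [map_sum]
    refine Finset.sum_congr rfl fun x _ => ?_
    rw [← Complex.exp_conj, map_mul, Complex.conj_I, Complex.conj_ofReal]
    push_cast
    ring_nf
  rw [this, norm_div, norm_div, Complex.norm_conj]

/-- Quadratic decay of the characteristic function on the scale `1 / M`. -/
lemma norm_uniformChar_le_one_sub {M : ℕ} (hM : 4 ≤ M) {a L : ℝ} (hL : 3 ≤ L)
    (ha : |a| ≤ Real.pi) (haL : M * |a| / 2 ≤ L) :
    ‖uniformChar M a‖ ≤ 1 - (M * a / 2) ^ 2 / (5 * L ^ 2) := by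
  have hM0 : 0 < M := by omega
  have hMr : (4 : ℝ) ≤ M := by exact_mod_cast hM
  wlog h0 : 0 ≤ a generalizing a
  · have := this (a := -a) (by simpa using ha) (by simpa using haL) (by linarith)
    rw [norm_uniformChar_neg] at this
    convert this using 2
    ring
  rw [abs_of_nonneg h0] at ha haL
  set z := M * a / 2 with hz
  have hz0 : 0 ≤ z := by positivity
  have hden : 0 < 5 * L ^ 2 := by positivity
  rcases le_or_gt z 2 with h2 | h2
  · rcases h0.eq_or_lt with rfl | hpos
    · simpa [hz] using norm_uniformChar_le_one M 0
    have hbd : z ^ 2 / (5 * L ^ 2) ≤ z ^ 2 / 40 := by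
      gcongr
      nlinarith
    refine le_trans ?_ (sub_le_sub_left hbd 1)
    have hy : a / 2 = z / M := by rw [hz]; field_simp
    have hzpos : 0 < z := by positivity
    have hs := norm_uniformChar_mul_sin hM0 a
    have hsin : a / 2 * (1 - z ^ 2 / 64) ≤ Real.sin (a / 2) := by
      have h := Real.sin_gt_sub_cube (x := a / 2) (by positivity)
      have : (a / 2) ^ 2 ≤ z ^ 2 / 16 := by
        rw [hy, div_pow]
        gcongr
        nlinarith
      nlinarith [mul_le_mul_of_nonneg_left this (show 0 ≤ a / 2 by positivity),
        mul_nonneg (show 0 ≤ a / 2 by positivity) (sq_nonneg z)]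
    have hsinz := sin_le_self_mul_one_sub hz0 h2
    have hsz : 0 ≤ Real.sin z :=
      Real.sin_nonneg_of_nonneg_of_le_pi hz0 (by linarith [Real.pi_gt_three])
    rw [← hz, abs_of_nonneg hsz] at hs
    have hlow : z * (1 - z ^ 2 / 64) ≤ M * |Real.sin (a / 2)| := by
      calc z * (1 - z ^ 2 / 64) = M * (a / 2 * (1 - z ^ 2 / 64)) := by rw [hz]; ring
        _ ≤ M * |Real.sin (a / 2)| := by
          gcongr
          exact hsin.trans (le_abs_self _)
    have hpos' : 0 < z * (1 - z ^ 2 / 64) := mul_pos hzpos (by nlinarith)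
    have hle : ‖uniformChar M a‖ * (z * (1 - z ^ 2 / 64)) ≤ z * (1 - z ^ 2 / 20) := by
      calc _ ≤ ‖uniformChar M a‖ * (M * |Real.sin (a / 2)|) := by gcongr
        _ ≤ _ := hs.trans_le hsinz
    have hfin : z * (1 - z ^ 2 / 20) ≤ (1 - z ^ 2 / 40) * (z * (1 - z ^ 2 / 64)) := by
      have : 0 ≤ z * z ^ 2 := by positivity
      have h4 : 0 ≤ z * z ^ 4 := by positivity
      nlinarith
    exact le_of_mul_le_mul_right (hle.trans hfin) hpos'
  · have hsin := two_div_pi_mul_abs_le_abs_sin (y := a / 2)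
      (by rw [abs_of_nonneg (by positivity)]; linarith)
    rw [abs_of_nonneg (a := a / 2) (by positivity)] at hsin
    have hK : 4 / Real.pi ≤ M * |Real.sin (a / 2)| := by
      calc 4 / Real.pi = 2 / Real.pi * 2 := by ring
        _ ≤ 2 / Real.pi * z := by gcongr
        _ = M * (2 / Real.pi * (a / 2)) := by rw [hz]; ring
        _ ≤ _ := by gcongr
    have h := norm_uniformChar_le_inv hM0 (by positivity) hK
    have hp : 1 / (4 / Real.pi) ≤ 4 / 5 := by
      rw [one_div_div]; linarith [Real.pi_lt_d2]
    have : z ^ 2 / (5 * L ^ 2) ≤ 1 / 5 := by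
      rw [div_le_div_iff₀ hden (by norm_num)]
      nlinarith
    linarith

lemma abs_sin_sub_le (x y : ℝ) : |Real.sin (x - y)| ≤ |Real.sin x| + |Real.sin y| := by
  rw [Real.sin_sub]
  refine (abs_sub _ _).trans ?_
  rw [abs_mul, abs_mul]
  exact add_le_add (mul_le_of_le_one_right (abs_nonneg _) (Real.abs_cos_le_one y))
    (mul_le_of_le_one_left (abs_nonneg _) (Real.abs_cos_le_one x))

lemma norm_stepChar_le (M : ℕ) (θ : ℝ × ℝ) :
    ‖stepChar M θ‖ ≤
      (‖uniformChar M θ.1‖ + ‖uniformChar M (θ.2 - θ.1)‖ + ‖uniformChar M (-θ.2)‖) / 3 := by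
  unfold stepChar
  rw [norm_div, Complex.norm_ofNat]
  gcongr
  exact norm_add₃_le

/-- If one half-angle sine is at least `2 K / M`, then two of the three are at least `K / M` and the
step characteristic function is barely larger than `1 / 3`. -/
lemma norm_stepChar_le_of_le_sin {M : ℕ} (hM : 0 < M) {K : ℝ} (hK : 0 < K) {θ : ℝ × ℝ}
    (h : (2 * K ≤ M * |Real.sin (θ.1 / 2)|) ∨ (2 * K ≤ M * |Real.sin (θ.2 / 2)|)) :
    ‖stepChar M θ‖ ≤ (1 + 2 / K) / 3 := by
  set s₁ := |Real.sin (θ.1 / 2)|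
  set s₂ := |Real.sin ((θ.2 - θ.1) / 2)|
  set s₃ := |Real.sin (-θ.2 / 2)| with hs₃
  have e₃ : |Real.sin (θ.2 / 2)| = s₃ := by
    rw [hs₃, neg_div, Real.sin_neg, abs_neg]
  rw [e₃] at h
  have t₁ : s₁ ≤ s₃ + s₂ := by
    have := abs_sin_sub_le (θ.2 / 2) ((θ.2 - θ.1) / 2)
    rwa [e₃, show θ.2 / 2 - (θ.2 - θ.1) / 2 = θ.1 / 2 by ring] at this
  have t₃ : s₃ ≤ s₁ + s₂ := by
    have := abs_sin_sub_le (θ.1 / 2) (-((θ.2 - θ.1) / 2))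
    rwa [Real.sin_neg ((θ.2 - θ.1) / 2), abs_neg,
      show θ.1 / 2 - -((θ.2 - θ.1) / 2) = θ.2 / 2 by ring, e₃] at this
  have hMr : (0 : ℝ) < M := by exact_mod_cast hM
  have m₁ := mul_le_mul_of_nonneg_left t₁ hMr.le
  have m₃ := mul_le_mul_of_nonneg_left t₃ hMr.le
  refine (norm_stepChar_le M θ).trans ?_
  have b₁ := norm_uniformChar_le_one M θ.1
  have b₂ := norm_uniformChar_le_one M (θ.2 - θ.1)
  have b₃ := norm_uniformChar_le_one M (-θ.2)
  have c₁ : K ≤ M * s₁ → _ := norm_uniformChar_le_inv (a := θ.1) hM hK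
  have c₂ : K ≤ M * s₂ → _ := norm_uniformChar_le_inv (a := θ.2 - θ.1) hM hK
  have c₃ : K ≤ M * s₃ → _ := norm_uniformChar_le_inv (a := -θ.2) hM hK
  have hd : 2 / K = 1 / K + 1 / K := by ring
  rw [hd]
  refine div_le_div_of_nonneg_right ?_ (by norm_num)
  by_cases k₁ : K ≤ M * s₁
  · by_cases k₂ : K ≤ M * s₂
    · linarith [c₁ k₁, c₂ k₂]
    · have k₃ : K ≤ M * s₃ := by rcases h with h | h <;> linarith
      linarith [c₁ k₁, c₃ k₃]
  · have k₃ : K ≤ M * s₃ := by rcases h with h | h <;> linarith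
    have k₂ : K ≤ M * s₂ := by rcases h with h | h <;> linarith
    linarith [c₂ k₂, c₃ k₃]

lemma norm_stepChar_le_off_center {M : ℕ} (hM : 0 < M) {L : ℝ} (hL : 0 < L) {θ : ℝ × ℝ}
    (hθ : θ ∈ torusBox) (h : L < M * |θ.1| / 2 ∨ L < M * |θ.2| / 2) :
    ‖stepChar M θ‖ ≤ (1 + 2 * Real.pi / L) / 3 := by
  have key : ∀ t ∈ Set.Icc (-Real.pi) Real.pi, L < M * |t| / 2 →
      2 * (L / Real.pi) ≤ M * |Real.sin (t / 2)| := by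
    intro t ht hlt
    have habs : |t / 2| ≤ Real.pi / 2 := by
      rw [abs_div, abs_two]
      exact div_le_div_of_nonneg_right (abs_le.mpr ht) (by norm_num)
    have hs := two_div_pi_mul_abs_le_abs_sin habs
    calc 2 * (L / Real.pi) = 2 / Real.pi * L := by ring
      _ ≤ 2 / Real.pi * (M * |t| / 2) := by gcongr
      _ = M * (2 / Real.pi * |t / 2|) := by rw [abs_div, abs_two]; ring
      _ ≤ _ := by gcongr
  have := norm_stepChar_le_of_le_sin hM (K := L / Real.pi) (by positivity) (θ := θ)
    (h.imp (key _ hθ.1) (key _ hθ.2))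
  rwa [div_div_eq_mul_div] at this

lemma norm_stepChar_le_center {M : ℕ} (hM : 4 ≤ M) {L : ℝ} (hL : 3 ≤ L) {θ : ℝ × ℝ}
    (hθ : θ ∈ torusBox) (h₁ : M * |θ.1| / 2 ≤ L) (h₂ : M * |θ.2| / 2 ≤ L) :
    ‖stepChar M θ‖ ≤ Real.exp (-(M ^ 2 * (θ.1 ^ 2 + θ.2 ^ 2) / (60 * L ^ 2))) := by
  have b₁ := norm_uniformChar_le_one_sub hM hL (abs_le.mpr hθ.1) h₁
  have b₂ := norm_uniformChar_le_one_sub hM hL (abs_le.mpr hθ.2) h₂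
  have b := norm_uniformChar_le_one M (θ.2 - θ.1)
  have hs := norm_stepChar_le M θ
  rw [norm_uniformChar_neg] at hs
  have he := Real.add_one_le_exp (-(M ^ 2 * (θ.1 ^ 2 + θ.2 ^ 2) / (60 * L ^ 2)))
  have e : M ^ 2 * (θ.1 ^ 2 + θ.2 ^ 2) / (60 * L ^ 2) =
      ((M * θ.1 / 2) ^ 2 / (5 * L ^ 2) + (M * θ.2 / 2) ^ 2 / (5 * L ^ 2)) / 3 := by
    field_simp
    ring
  linarith

/-- The mean of the uniform distribution on `{1,…,M}`, as a complex number. -/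
noncomputable def uniformMean (M : ℕ) : ℂ := (∑ x : Fin M, ((x : ℕ) + 1 : ℂ)) / M

lemma norm_exp_I_mul_sub_taylor_le {t : ℝ} (ht : |t| ≤ 1) :
    ‖Complex.exp (Complex.I * t) - (1 + Complex.I * t - t ^ 2 / 2)‖ ≤ |t| ^ 3 := by
  have hn : ‖Complex.I * (t : ℂ)‖ = |t| := by simp
  have h := Complex.exp_bound (x := Complex.I * t) (by rw [hn]; exact ht) (n := 3) (by norm_num)
  rw [hn] at h
  simp only [Finset.sum_range_succ, Finset.sum_range_zero, mul_pow, Complex.I_sq] at h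
  norm_num [Nat.factorial] at h
  refine le_trans (le_of_eq ?_) (h.trans ?_)
  · congr 1
    ring
  · nlinarith [pow_nonneg (abs_nonneg t) 3]

lemma sum_fin_succ_sq (M : ℕ) :
    ∑ x : Fin M, ((x : ℕ) + 1 : ℝ) ^ 2 = M * (M + 1) * (2 * M + 1) / 6 := by
  rw [Fin.sum_univ_eq_sum_range (fun i => ((i : ℝ) + 1) ^ 2)]
  induction M with
  | zero => simp
  | succ k ih => rw [Finset.sum_range_succ, ih]; push_cast; ring

lemma norm_uniformChar_sub_taylor_le {M : ℕ} (hM : 0 < M) {a : ℝ} (ha : M * |a| ≤ 1) :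
    ‖uniformChar M a - 1 - Complex.I * a * uniformMean M + ((M * a) ^ 2 * cM M / 2 : ℝ)‖ ≤
      (M * |a|) ^ 3 := by
  have hMr : (0 : ℝ) < M := by exact_mod_cast hM
  have hM' : (M : ℂ) ≠ 0 := by exact_mod_cast hM.ne'
  have e : uniformChar M a - 1 - Complex.I * a * uniformMean M +
      ((M * a) ^ 2 * cM M / 2 : ℝ) =
      (∑ x : Fin M, (Complex.exp (Complex.I * (((x : ℕ) + 1 : ℝ) * a : ℝ)) -
        (1 + Complex.I * (((x : ℕ) + 1 : ℝ) * a : ℝ) -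
          (((x : ℕ) + 1 : ℝ) * a : ℝ) ^ 2 / 2))) / M := by
    have hsq : (((M * a) ^ 2 * cM M / 2 : ℝ) : ℂ) =
        (∑ x : Fin M, ((((x : ℕ) + 1 : ℝ) * a : ℝ) : ℂ) ^ 2 / 2) / M := by
      have : (M * a) ^ 2 * cM M / 2 = (∑ x : Fin M, (((x : ℕ) + 1 : ℝ) * a) ^ 2 / 2) / M := by
        simp_rw [mul_pow]
        rw [← Finset.sum_div, ← Finset.sum_mul, sum_fin_succ_sq]
        unfold cM
        field_simp
      rw [this]
      push_cast
      rfl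
    have hlin : Complex.I * a * uniformMean M =
        (∑ x : Fin M, Complex.I * (((x : ℕ) + 1 : ℝ) * a : ℝ)) / M := by
      unfold uniformMean
      rw [← mul_div_assoc, Finset.mul_sum]
      congr 1
      refine Finset.sum_congr rfl fun x _ => ?_
      push_cast
      ring
    have hone : (1 : ℂ) = (∑ _x : Fin M, (1 : ℂ)) / M := by simp [hM']
    rw [hsq, hlin, Finset.sum_sub_distrib, Finset.sum_sub_distrib, Finset.sum_add_distrib]
    nth_rewrite 1 [hone]
    unfold uniformChar
    ring
  rw [e, norm_div, Complex.norm_natCast, div_le_iff₀ hMr]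
  refine (norm_sum_le _ _).trans ?_
  have hterm : ∀ x : Fin M, |((x : ℕ) + 1 : ℝ) * a| ≤ M * |a| := by
    intro x
    rw [abs_mul, abs_of_nonneg (by positivity)]
    gcongr
    exact_mod_cast x.2
  calc _ ≤ ∑ _x : Fin M, (M * |a|) ^ 3 := by
        refine Finset.sum_le_sum fun x _ => ?_
        refine (norm_exp_I_mul_sub_taylor_le ((hterm x).trans ha)).trans ?_
        gcongr
        exact hterm x
    _ = (M * |a|) ^ 3 * M := by simp [mul_comm]

lemma tendsto_cM : Tendsto cM atTop (𝓝 (1 / 3)) := by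
  have hinv : Tendsto (fun M : ℕ => ((M : ℝ))⁻¹) atTop (𝓝 0) :=
    tendsto_inv_atTop_zero.comp tendsto_natCast_atTop_atTop
  have h : Tendsto (fun M : ℕ => (1 + (M : ℝ)⁻¹) * (2 + (M : ℝ)⁻¹) / 6) atTop
      (𝓝 ((1 + 0) * (2 + 0) / 6)) :=
    ((hinv.const_add 1).mul (hinv.const_add 2)).div_const 6
  rw [show (1 + 0) * (2 + 0) / 6 = (1 / 3 : ℝ) by norm_num] at h
  refine h.congr' ?_
  filter_upwards [eventually_gt_atTop 0] with M hM
  have : (M : ℝ) ≠ 0 := by exact_mod_cast hM.ne'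
  unfold cM
  field_simp

lemma tendsto_uniformChar_scaled {M : ℕ → ℕ} (hM1 : ∀ n, 1 ≤ M n) (hMtop : Tendsto M atTop atTop)
    (u : ℝ) :
    Tendsto (fun n : ℕ => (n : ℂ) * (uniformChar (M n) (u / (M n * √n)) - 1 -
      Complex.I * (u / (M n * √n) : ℝ) * uniformMean (M n))) atTop (𝓝 (-(u ^ 2 / 6 : ℝ))) := by
  have hsq : Tendsto (fun n : ℕ => √(n : ℝ)) atTop atTop :=
    Real.tendsto_sqrt_atTop.comp tendsto_natCast_atTop_atTop
  have hc : Tendsto (fun n : ℕ => ((-(u ^ 2 * cM (M n) / 2) : ℝ) : ℂ)) atTop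
      (𝓝 (-(u ^ 2 / 6 : ℝ))) := by
    have := (((tendsto_cM.comp hMtop).const_mul (u ^ 2)).div_const 2).neg
    rw [show -(u ^ 2 * (1 / 3) / 2) = -(u ^ 2 / 6) by ring] at this
    rw [← Complex.ofReal_neg]
    exact (Complex.continuous_ofReal.tendsto _).comp this
  have herr : Tendsto (fun n : ℕ => |u| ^ 3 / √n) atTop (𝓝 0) :=
    hsq.const_div_atTop _
  refine hc.congr_dist ?_
  refine squeeze_zero' (Eventually.of_forall fun _ => dist_nonneg) ?_ herr
  filter_upwards [eventually_gt_atTop 0, hsq.eventually_ge_atTop (|u|)] with n hn hu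
  have hMr : (0 : ℝ) < M n := by exact_mod_cast hM1 n
  have hnr : (0 : ℝ) < n := by exact_mod_cast hn
  have hs : 0 < √(n : ℝ) := Real.sqrt_pos.mpr hnr
  have hss : √(n : ℝ) ^ 2 = n := Real.sq_sqrt hnr.le
  have hMa : M n * |u / (M n * √n)| = |u| / √n := by
    rw [abs_div, abs_of_pos (mul_pos hMr hs)]
    field_simp
  have h := norm_uniformChar_sub_taylor_le (hM1 n) (a := u / (M n * √n))
    (by rw [hMa]; exact div_le_one_of_le₀ hu hs.le)
  rw [hMa] at h
  have hsec : (M n * (u / (M n * √n))) ^ 2 * cM (M n) / 2 = u ^ 2 * cM (M n) / 2 / n := by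
    rw [div_eq_iff two_ne_zero]
    simp only [mul_pow, div_pow, hss]
    field_simp
  rw [hsec] at h
  rw [dist_comm, dist_eq_norm]
  have hnc : (n : ℂ) ≠ 0 := by exact_mod_cast hn.ne'
  calc _ = ‖(n : ℂ) * (uniformChar (M n) (u / (M n * √n)) - 1 -
          Complex.I * (u / (M n * √n) : ℝ) * uniformMean (M n) +
          (u ^ 2 * cM (M n) / 2 / n : ℝ))‖ := by
        congr 1
        rw [mul_add, Complex.ofReal_neg, sub_neg_eq_add, Complex.ofReal_div _ (n : ℝ),
          Complex.ofReal_natCast, mul_div_cancel₀ _ hnc]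
    _ ≤ n * (|u| / √n) ^ 3 := by
        rw [norm_mul, Complex.norm_natCast]
        gcongr
    _ = |u| ^ 3 / √n := by
        nth_rewrite 1 [← hss]
        field_simp

/-- The quadratic form in the exponent of the limiting Gaussian density. -/
noncomputable def limitForm (u : ℝ × ℝ) : ℝ := (u.1 ^ 2 - u.1 * u.2 + u.2 ^ 2) / 9

lemma tendsto_stepChar_pow {M : ℕ → ℕ} (hM1 : ∀ n, 1 ≤ M n) (hMtop : Tendsto M atTop atTop)
    (u : ℝ × ℝ) :
    Tendsto (fun n : ℕ => stepChar (M n) ((M n * √n : ℝ)⁻¹ • u) ^ n) atTop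
      (𝓝 (Real.exp (-limitForm u) : ℝ)) := by
  have h := (((tendsto_uniformChar_scaled hM1 hMtop u.1).add
    (tendsto_uniformChar_scaled hM1 hMtop (u.2 - u.1))).add
    (tendsto_uniformChar_scaled hM1 hMtop (-u.2))).div_const 3
  have h' : Tendsto (fun n : ℕ => (n : ℂ) * (stepChar (M n) ((M n * √n : ℝ)⁻¹ • u) - 1)) atTop
      (𝓝 ((-limitForm u : ℝ) : ℂ)) := by
    convert h using 2 with n
    · unfold stepChar
      simp only [Prod.smul_fst, Prod.smul_snd, smul_eq_mul]
      have e1 : (M n * √n : ℝ)⁻¹ * u.1 = u.1 / (M n * √n) := by ring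
      have e2 : (M n * √n : ℝ)⁻¹ * u.2 - (M n * √n : ℝ)⁻¹ * u.1 =
        (u.2 - u.1) / (M n * √n) := by ring
      have e3 : -((M n * √n : ℝ)⁻¹ * u.2) = -u.2 / (M n * √n) := by ring
      rw [e2, e3, e1]
      push_cast
      ring
    · unfold limitForm
      push_cast
      ring
  have := Complex.tendsto_one_add_pow_exp_of_tendsto h'
  simpa using this

/-- The part of the torus where both angles are at most `2 L / M`. -/
def centerBox (M : ℕ) (L : ℝ) : Set (ℝ × ℝ) :=
  torusBox ∩ {θ | M * |θ.1| / 2 ≤ L ∧ M * |θ.2| / 2 ≤ L}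

lemma measurableSet_torusBox : MeasurableSet torusBox := measurableSet_Icc.prod measurableSet_Icc

lemma measurableSet_centerBox (M : ℕ) (L : ℝ) : MeasurableSet (centerBox M L) := by
  refine measurableSet_torusBox.inter (MeasurableSet.inter ?_ ?_)
  · exact (isClosed_le (by fun_prop : Continuous fun θ : ℝ × ℝ => M * |θ.1| / 2)
      continuous_const).measurableSet
  · exact (isClosed_le (by fun_prop : Continuous fun θ : ℝ × ℝ => M * |θ.2| / 2)
      continuous_const).measurableSet

lemma volume_torusBox : volume torusBox = ENNReal.ofReal (4 * Real.pi ^ 2) := by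
  unfold torusBox
  rw [Measure.volume_eq_prod, Measure.prod_prod, Real.volume_Icc,
    ← ENNReal.ofReal_mul (by linarith [Real.pi_pos])]
  ring_nf

lemma integrable_gaussian_prod {c : ℝ} (hc : 0 < c) :
    Integrable fun u : ℝ × ℝ => Real.exp (-(c * (u.1 ^ 2 + u.2 ^ 2))) := by
  have h := (integrable_exp_neg_mul_sq hc).mul_prod (integrable_exp_neg_mul_sq hc)
  rw [← Measure.volume_eq_prod] at h
  refine h.congr (Eventually.of_forall fun u => ?_)
  simp only
  rw [← Real.exp_add]
  ring_nf

lemma integrable_exp_neg_limitForm : Integrable fun u : ℝ × ℝ => Real.exp (-limitForm u) := by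
  refine (integrable_gaussian_prod (c := 1 / 18) (by norm_num)).mono' ?_ ?_
  · unfold limitForm
    exact Continuous.aestronglyMeasurable (by fun_prop)
  · refine Eventually.of_forall fun u => ?_
    rw [Real.norm_eq_abs, Real.abs_exp, Real.exp_le_exp]
    unfold limitForm
    nlinarith [sq_nonneg (u.1 - u.2)]

lemma integral_exp_neg_limitForm :
    ∫ u : ℝ × ℝ, Real.exp (-limitForm u) = 6 * √3 * Real.pi := by
  have hint := integrable_exp_neg_limitForm
  rw [Measure.volume_eq_prod] at hint ⊢
  rw [integral_prod _ hint]
  have inner : ∀ x : ℝ, ∫ y : ℝ, Real.exp (-limitForm (x, y)) =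
      √(Real.pi / (1 / 9)) * Real.exp (-(1 / 12) * x ^ 2) := by
    intro x
    have e : ∀ y : ℝ, Real.exp (-limitForm (x, y)) =
        Real.exp (-(1 / 9) * (y - x / 2) ^ 2) * Real.exp (-(1 / 12) * x ^ 2) := by
      intro y
      rw [← Real.exp_add]
      unfold limitForm
      ring_nf
    simp_rw [e]
    rw [integral_mul_const, integral_sub_right_eq_self (fun y => Real.exp (-(1 / 9) * y ^ 2)),
      integral_gaussian]
  simp_rw [inner]
  rw [integral_const_mul, integral_gaussian, ← Real.sqrt_mul (by positivity),
    show Real.pi / (1 / 9) * (Real.pi / (1 / 12)) = (6 * Real.pi) ^ 2 * 3 by ring,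
    Real.sqrt_mul (by positivity), Real.sqrt_sq (by positivity)]
  ring

lemma tendsto_integral_centerBox {M : ℕ → ℕ} (hM1 : ∀ n, 1 ≤ M n)
    (hMtop : Tendsto M atTop atTop) {L : ℝ} (hL : 3 ≤ L) :
    Tendsto (fun n : ℕ => ((M n * √n : ℝ) ^ 2 : ℂ) *
      ∫ θ in centerBox (M n) L, stepChar (M n) θ ^ n) atTop
      (𝓝 ((6 * √3 * Real.pi : ℝ) : ℂ)) := by
  have hsq : Tendsto (fun n : ℕ => √(n : ℝ)) atTop atTop :=
    Real.tendsto_sqrt_atTop.comp tendsto_natCast_atTop_atTop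
  set G : ℕ → ℝ × ℝ → ℂ := fun n u =>
    (centerBox (M n) L).indicator (fun θ => stepChar (M n) θ ^ n) ((M n * √n : ℝ)⁻¹ • u) with hG
  have hlim : Tendsto (fun n => ∫ u, G n u) atTop
      (𝓝 (∫ u : ℝ × ℝ, ((Real.exp (-limitForm u) : ℝ) : ℂ))) := by
    refine tendsto_integral_filter_of_dominated_convergence
      (fun u => Real.exp (-(1 / (60 * L ^ 2) * (u.1 ^ 2 + u.2 ^ 2)))) ?_ ?_
      (integrable_gaussian_prod (by positivity)) ?_
    · refine Eventually.of_forall fun n => ?_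
      have hm : Measurable ((centerBox (M n) L).indicator fun θ => stepChar (M n) θ ^ n) :=
        ((continuous_stepChar _).pow n).measurable.indicator (measurableSet_centerBox _ _)
      exact (hm.comp (measurable_const_smul _)).aestronglyMeasurable
    · filter_upwards [hMtop.eventually_ge_atTop 4, eventually_gt_atTop 0] with n hM hn
      refine Eventually.of_forall fun u => ?_
      simp only [hG, Set.indicator]
      split_ifs with hmem
      · have hMr : (0 : ℝ) < M n := by exact_mod_cast hM1 n
        have hnr : (0 : ℝ) < n := by exact_mod_cast hn
        have hss : √(n : ℝ) ^ 2 = n := Real.sq_sqrt hnr.le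
        have hb := norm_stepChar_le_center hM hL hmem.1 hmem.2.1 hmem.2.2
        rw [norm_pow]
        refine (pow_le_pow_left₀ (norm_nonneg _) hb n).trans (le_of_eq ?_)
        rw [← Real.exp_nat_mul]
        congr 1
        simp only [Prod.smul_fst, Prod.smul_snd, smul_eq_mul]
        simp only [mul_pow, inv_pow, hss]
        field_simp
      · simp only [norm_zero]
        positivity
    · refine Eventually.of_forall fun u => ?_
      refine (tendsto_stepChar_pow hM1 hMtop u).congr' ?_
      have hMreal : ∀ n, (1 : ℝ) ≤ M n := fun n => by exact_mod_cast hM1 n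
      have small : ∀ v : ℝ, ∀ᶠ n : ℕ in atTop,
          (M n * √n : ℝ)⁻¹ * v ∈ Set.Icc (-Real.pi) Real.pi ∧
          M n * |(M n * √n : ℝ)⁻¹ * v| / 2 ≤ L := by
        intro v
        filter_upwards [hsq.eventually_ge_atTop (|v|), hsq.eventually_gt_atTop 0] with n hv hs
        have hMr := hMreal n
        have hMpos : (0 : ℝ) < M n := by linarith
        have hx : M n * |(M n * √n : ℝ)⁻¹ * v| = |v| / √n := by
          rw [abs_mul, abs_of_pos (inv_pos.mpr (mul_pos hMpos hs))]
          field_simp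
        have h1 : |v| / √n ≤ 1 := div_le_one_of_le₀ hv hs.le
        have habs : |(M n * √n : ℝ)⁻¹ * v| ≤ 1 := by
          nlinarith [abs_nonneg ((M n * √n : ℝ)⁻¹ * v)]
        exact ⟨abs_le.mp (habs.trans (by linarith [Real.pi_gt_three])), by rw [hx]; linarith⟩
      filter_upwards [small u.1, small u.2] with n h1 h2
      simp only [hG]
      rw [Set.indicator_of_mem]
      exact ⟨⟨h1.1, h2.1⟩, h1.2, h2.2⟩
  rw [integral_complex_ofReal, integral_exp_neg_limitForm] at hlim
  refine hlim.congr' (Eventually.of_forall fun n => ?_)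
  simp only [hG]
  rw [Measure.integral_comp_smul volume
    ((centerBox (M n) L).indicator fun θ => stepChar (M n) θ ^ n),
    integral_indicator (measurableSet_centerBox _ _), Module.finrank_prod, Module.finrank_self,
    inv_pow, inv_inv, abs_of_nonneg (by positivity), Complex.real_smul, Complex.ofReal_pow]

lemma tendsto_integral_torusBox {M : ℕ → ℕ} (hM1 : ∀ n, 1 ≤ M n)
    (hMtop : Tendsto M atTop atTop) {L : ℝ} (hL : 3 ≤ L)
    (hsmall : Tendsto (fun n : ℕ => (n : ℝ) * (M n : ℝ) ^ 2 * ((1 + 2 * Real.pi / L) / 3) ^ n)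
      atTop (𝓝 0)) :
    Tendsto (fun n : ℕ => ((M n * √n : ℝ) ^ 2 : ℂ) *
      ∫ θ in torusBox, stepChar (M n) θ ^ n) atTop (𝓝 ((6 * √3 * Real.pi : ℝ) : ℂ)) := by
  refine (tendsto_integral_centerBox hM1 hMtop hL).congr_dist ?_
  have h0 : Tendsto (fun n : ℕ => (n : ℝ) * (M n : ℝ) ^ 2 * ((1 + 2 * Real.pi / L) / 3) ^ n *
      (4 * Real.pi ^ 2)) atTop (𝓝 0) := by
    simpa using hsmall.mul_const (4 * Real.pi ^ 2)
  refine squeeze_zero (fun _ => dist_nonneg) (fun n => ?_) h0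
  have hsub : centerBox (M n) L ⊆ torusBox := Set.inter_subset_left
  have hfin : volume torusBox ≠ ⊤ := by rw [volume_torusBox]; exact ENNReal.ofReal_ne_top
  have hdiff := setIntegral_sdiff (f := fun θ => stepChar (M n) θ ^ n)
    (measurableSet_centerBox (M n) L)
    (integrableOn_torusBox ((continuous_stepChar (M n)).pow n)) hsub
  rw [dist_comm, dist_eq_norm, ← mul_sub]
  rw [← hdiff, norm_mul]
  have hn2 : ‖((M n * √n : ℝ) ^ 2 : ℂ)‖ = n * (M n : ℝ) ^ 2 := by
    rw [norm_pow, Complex.norm_real, Real.norm_eq_abs, sq_abs, mul_pow,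
      Real.sq_sqrt (Nat.cast_nonneg n)]
    ring
  rw [hn2, mul_assoc (_ * _)]
  refine mul_le_mul_of_nonneg_left ?_ (by positivity)
  have hq : 0 ≤ (1 + 2 * Real.pi / L) / 3 := by positivity
  have hvol : volume.real (torusBox \ centerBox (M n) L) ≤ 4 * Real.pi ^ 2 := by
    refine (measureReal_mono Set.sdiff_subset hfin).trans (le_of_eq ?_)
    rw [measureReal_def, volume_torusBox, ENNReal.toReal_ofReal (by positivity)]
  refine (norm_setIntegral_le_of_norm_le_const
    ((measure_mono Set.sdiff_subset).trans_lt hfin.lt_top) (C := ((1 + 2 * Real.pi / L) / 3) ^ n)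
    fun θ hθ => ?_).trans (by gcongr)
  rw [norm_pow]
  refine pow_le_pow_left₀ (norm_nonneg _) ?_ n
  refine norm_stepChar_le_off_center (hM1 n) (by linarith) hθ.1 ?_
  by_contra hcon
  push Not at hcon
  exact hθ.2 ⟨hθ.1, hcon⟩

/-- Since `2 / κ < log 3`, the square of `M` is exponentially smaller than `3 ^ n`. -/
lemma exists_tendsto_mul_sq_mul_pow {M : ℕ → ℕ} (hM1 : ∀ n, 1 ≤ M n) {κ : ℝ}
    (hκ : Tendsto (fun n : ℕ => (n : ℝ) / Real.log (M n)) atTop (𝓝 κ))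
    (hκgt : 2 / Real.log 3 < κ) :
    ∃ L : ℝ, 3 ≤ L ∧ Tendsto (fun n : ℕ => (n : ℝ) * (M n : ℝ) ^ 2 *
      ((1 + 2 * Real.pi / L) / 3) ^ n) atTop (𝓝 0) := by
  have hl3 : 0 < Real.log 3 := Real.log_pos (by norm_num)
  have hκ0 : 0 < κ := lt_trans (by positivity) hκgt
  have hr : 2 * κ⁻¹ < Real.log 3 := by
    rw [div_lt_iff₀ hl3] at hκgt
    rw [← div_eq_mul_inv, div_lt_iff₀ hκ0]
    linarith
  obtain ⟨r, hr1, hr2⟩ := exists_between hr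
  have hL : ∀ᶠ L : ℝ in atTop, (1 + 2 * Real.pi / L) / 3 * Real.exp r < 1 := by
    have ht : Tendsto (fun L : ℝ => (1 + 2 * Real.pi / L) / 3 * Real.exp r) atTop
        (𝓝 ((1 + 0) / 3 * Real.exp r)) :=
      (((tendsto_id.const_div_atTop (2 * Real.pi)).const_add 1).div_const 3).mul_const _
    refine ht.eventually_lt_const ?_
    have : Real.exp r < 3 := by
      rw [← Real.lt_log_iff_exp_lt (by norm_num)]
      exact hr2
    linarith
  obtain ⟨L, hL1, hL3⟩ := (hL.and (eventually_ge_atTop 3)).exists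
  refine ⟨L, hL3, ?_⟩
  have hq : 0 ≤ (1 + 2 * Real.pi / L) / 3 := by positivity
  have hinv : Tendsto (fun n : ℕ => Real.log (M n) / n) atTop (𝓝 κ⁻¹) := by
    refine (hκ.inv₀ hκ0.ne').congr fun n => ?_
    rw [inv_div]
  have hev := hinv.eventually_lt_const (show κ⁻¹ < r / 2 by linarith)
  refine squeeze_zero' (Eventually.of_forall fun n => by positivity) ?_
    (tendsto_self_mul_const_pow_of_lt_one (mul_nonneg hq (Real.exp_pos r).le) hL1)
  filter_upwards [hev, eventually_gt_atTop 0] with n hlog hn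
  have hnr : (0 : ℝ) < n := by exact_mod_cast hn
  have hMr : (0 : ℝ) < M n := by exact_mod_cast hM1 n
  rw [div_lt_iff₀ hnr] at hlog
  have hM2 : (M n : ℝ) ^ 2 ≤ Real.exp r ^ n := by
    rw [← Real.exp_nat_mul, ← Real.log_le_iff_le_exp (by positivity), Real.log_pow]
    push_cast
    linarith
  rw [mul_pow, mul_assoc, mul_comm (_ ^ n) (Real.exp r ^ n)]
  gcongr

lemma tendsto_EZ_scaled {M : ℕ → ℕ} (hM1 : ∀ n, 1 ≤ M n)
    (hMtop : Tendsto M atTop atTop) {L : ℝ} (hL : 3 ≤ L)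
    (hsmall : Tendsto (fun n : ℕ => (n : ℝ) * (M n : ℝ) ^ 2 * ((1 + 2 * Real.pi / L) / 3) ^ n)
      atTop (𝓝 0)) :
    Tendsto (fun n : ℕ => EZ 3 n (M n) * (n * (M n : ℝ) ^ 2 / 3 ^ n)) atTop
      (𝓝 (3 * √3 / (2 * Real.pi))) := by
  have h := (tendsto_integral_torusBox hM1 hMtop hL hsmall).div_const (4 * Real.pi ^ 2 : ℂ)
  rw [← tendsto_ofReal_iff]
  have hpi : (Real.pi : ℂ) ≠ 0 := by exact_mod_cast Real.pi_ne_zero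
  have e : ((6 * √3 * Real.pi : ℝ) : ℂ) / (4 * Real.pi ^ 2) =
      ((3 * √3 / (2 * Real.pi) : ℝ) : ℂ) := by
    push_cast
    field_simp
    ring
  rw [e] at h
  refine h.congr' ?_
  filter_upwards [eventually_gt_atTop 0] with n hn
  have hs : ((M n * √n : ℝ) ^ 2 : ℂ) = n * (M n : ℂ) ^ 2 := by
    rw [← Complex.ofReal_pow, mul_pow, Real.sq_sqrt (Nat.cast_nonneg n)]
    push_cast
    ring
  rw [hs, Complex.ofReal_mul (EZ 3 n (M n)), EZ_eq_integral hn (hM1 n)]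
  push_cast
  field_simp

theorem expected_number_asymptotics_nu_three
    (M : ℕ → ℕ) (hM1 : ∀ n, 1 ≤ M n)
    (hMtop : Tendsto M atTop atTop)
    (hMO : ∃ C : ℝ, ∀ n : ℕ, Real.log (M n) ≤ C * n)
    (κ : ℝ)
    (hκ : Tendsto (fun n : ℕ => (n : ℝ) / Real.log (M n)) atTop (nhds κ))
    (hκgt : 2 / Real.log 3 < κ) (hκ2 : κ ≠ 2) (hκ4 : κ ≠ 4) :
    Tendsto
      (fun n => EZ 3 n (M n) /
        ((3 : ℝ) ^ n / (M n : ℝ) ^ 2 *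
          ((3 : ℝ) ^ ((3 : ℝ) / 2) / (2 * Real.pi * 3 * cM (M n) * n))))
      atTop (nhds 1) ∧
    Tendsto (fun n => EZ 3 n (M n)) atTop atTop := by
  obtain ⟨L, hL, hsmall⟩ := exists_tendsto_mul_sq_mul_pow hM1 hκ hκgt
  have hZ := tendsto_EZ_scaled hM1 hMtop hL hsmall
  have hpow : (3 : ℝ) ^ ((3 : ℝ) / 2) = 3 * √3 := by
    rw [show (3 : ℝ) / 2 = 1 + 1 / 2 by norm_num, Real.rpow_add (by norm_num), Real.rpow_one,
      Real.sqrt_eq_rpow]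
  constructor
  · have hlim := hZ.mul (((tendsto_cM.comp hMtop).const_mul (2 * Real.pi * 3)).div_const (3 * √3))
    have e : 3 * √3 / (2 * Real.pi) * (2 * Real.pi * 3 * (1 / 3) / (3 * √3)) = 1 := by
      have : √(3 : ℝ) ≠ 0 := by positivity
      field_simp
    rw [e] at hlim
    refine hlim.congr fun n => ?_
    rw [hpow, div_mul_div_comm, div_div_eq_mul_div, Function.comp_apply]
    ring
  · have hinv : Tendsto (fun n : ℕ => (n * (M n : ℝ) ^ 2 / 3 ^ n)) atTop (𝓝[>] 0) := by
      refine tendsto_nhdsWithin_iff.mpr ⟨?_, ?_⟩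
      · refine squeeze_zero (fun n => by positivity) (fun n => ?_) hsmall
        rw [div_pow, ← mul_div_assoc]
        refine div_le_div_of_nonneg_right ?_ (by positivity)
        refine le_mul_of_one_le_right (by positivity) (one_le_pow₀ ?_)
        have : 0 ≤ 2 * Real.pi / L := by positivity
        linarith
      · filter_upwards [eventually_gt_atTop 0] with n hn
        have hnr : (0 : ℝ) < n := by exact_mod_cast hn
        have hMr : (0 : ℝ) < M n := by exact_mod_cast hM1 n
        exact Set.mem_Ioi.mpr (by positivity)
    refine (hZ.pos_mul_atTop (by positivity) hinv.inv_tendsto_nhdsGT_zero).congr' ?_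
    filter_upwards [eventually_gt_atTop 0] with n hn
    have hnr : (0 : ℝ) < n := by exact_mod_cast hn
    have hMr : (0 : ℝ) < M n := by exact_mod_cast hM1 n
    rw [Pi.inv_apply, mul_assoc, mul_inv_cancel₀ (by positivity), mul_one]
end
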